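/- arXiv:1501.07253 — 4 statements merged into one kernel-verified Lean document; each statement's English description precedes it below -/
import Mathlib

section
/- For all a, b, k ∈ ℕ one has Σ_{j=0}^{k} (−1)^j · C(b, j) · C(a + (k−j) − 1, k−j) = s^k(a − b), where C(·,·) on the left denotes ordinary binomial coefficients (C(a+i−1, i) being the dimension of the i-th symmetric power of an a-dimensional space and C(b, j) the dimension of the j-th exterior power of a b-dimensional space), and a − b is taken in ℚ. This is the numerical content of the statement that for a finite-dimensional graded vector space W* with total even-degree dimension a and total odd-degree dimension b (so Euler characteristic χ(W*) = a − b), the Euler characteristic of the k-th symmetric power of W*, formed in the graded sense, equals s^k(χ(W*)). -/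
/-- `sPow χ k = (1/k!)·χ·(χ+1)⋯(χ+k−1)`, the generalized binomial coefficient
`C(χ+k−1, k)`, with `sPow χ 0 = 1`. -/
noncomputable def sPow (χ : ℚ) (k : ℕ) : ℚ := (ascPochhammer ℚ k).eval χ / k.factorial

open Finset in
/-- The Chu–Vandermonde identity for `Ring.multichoose`, with one argument negated. -/
theorem Ring.multichoose_sub_eq_sum {R : Type*} [CommRing R] [BinomialRing R] (r s : R) (k : ℕ) :
    Ring.multichoose (r - s) k =
      ∑ ij ∈ antidiagonal k, (-1) ^ ij.1 * Ring.choose s ij.1 * Ring.multichoose r ij.2 := by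
  have choose_neg_eq (t : R) (n : ℕ) :
      Ring.choose (-t) n = (-1) ^ n * Ring.multichoose t n := by
    rw [Ring.choose_neg', Int.negOnePow_def, Units.smul_def]
    simp
  have sign_mul_self (n : ℕ) : (-1 : R) ^ n * (-1) ^ n = 1 := by
    rw [← mul_pow]; simp
  calc Ring.multichoose (r - s) k
      = (-1) ^ k * Ring.choose (s + -r) k := by
        rw [← sub_eq_add_neg, ← neg_sub r s, choose_neg_eq, ← mul_assoc, sign_mul_self, one_mul]
    _ = _ := by
        rw [Ring.add_choose_eq k (Commute.all s (-r)), mul_sum]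
        refine sum_congr rfl fun ij hij => ?_
        rw [← mem_antidiagonal.mp hij, choose_neg_eq, pow_add]
        linear_combination
          (-1) ^ ij.1 * Ring.choose s ij.1 * Ring.multichoose r ij.2 * sign_mul_self ij.2

theorem sPow_eq_multichoose (χ : ℚ) (k : ℕ) : sPow χ k = Ring.multichoose χ k := by
  rw [sPow, div_eq_iff (by positivity), Polynomial.eval_eq_smeval,
    Polynomial.ascPochhammer_smeval_cast, ← Ring.factorial_nsmul_multichoose_eq_ascPochhammer,
    nsmul_eq_mul, mul_comm]

theorem sPow_natCast (a k : ℕ) : sPow a k = (a + k - 1).choose k := by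
  rw [sPow, div_eq_iff (by positivity), ← ascPochhammer_eval_cast,
    ascPochhammer_nat_eq_descFactorial, Nat.descFactorial_eq_factorial_mul_choose]
  push_cast
  ring

/-- For all `a, b, k ∈ ℕ`,
`Σ_{j=0}^{k} (−1)^j · C(b, j) · C(a + (k−j) − 1, k−j) = s^k(a − b)`,
the numerical form of the Euler-characteristic formula for the graded symmetric power
`S^k` of a graded vector space with even dimension `a` and odd dimension `b`. -/
theorem euler_char_symmetric_power (a b k : ℕ) :
    ∑ j ∈ Finset.range (k + 1),
        (-1 : ℚ) ^ j * (b.choose j : ℚ) * ((a + (k - j) - 1).choose (k - j) : ℚ) =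
      sPow ((a : ℚ) - (b : ℚ)) k := by
  rw [sPow_eq_multichoose, Ring.multichoose_sub_eq_sum,
    Finset.Nat.sum_antidiagonal_eq_sum_range_succ_mk]
  refine Finset.sum_congr rfl fun j _ => ?_
  rw [Ring.choose_natCast, ← sPow_eq_multichoose, sPow_natCast]
end

section
/- Let G be a finite group acting k-linearly on a k-vector space M via a representation ρ, let K be a finite index set with an action of G, and suppose M = ⊕_{i∈K} M_i is an internal direct sum decomposition into subspaces M_i such that ρ(g)(M_i) = M_{g·i} for all g ∈ G and i ∈ K. Let R ⊆ K be a set of representatives of the G-orbits in K. Then the space of G-invariants M^G = {m ∈ M : ρ(g)m = m for all g ∈ G} is isomorphic as a k-vector space to ⊕_{i∈R} M_i^{G_i}, where G_i ⊆ G is the stabilizer subgroup of i and M_i^{G_i} = {m ∈ M_i : ρ(g)m = m for all g ∈ G_i} (this makes sense since ρ(g)(M_i) = M_i for g ∈ G_i). -/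
open DirectSum

/-- The submodule of vectors fixed by `ρ g` for every `g` in a subset `S ⊆ G`. -/
def fixedSubmodule {k G M : Type*} [Field k] [Group G] [AddCommGroup M] [Module k M]
    (ρ : Representation k G M) (S : Set G) : Submodule k M where
  carrier := {m | ∀ g ∈ S, ρ g m = m}
  add_mem' := by
    intro x y hx hy g hg
    simp [map_add, hx g hg, hy g hg]
  zero_mem' := by
    intro g hg
    simp
  smul_mem' := by
    intro c x hx g hg
    simp [map_smul, hx g hg]

section

variable {k G M K : Type*} [Field k] [Group G] [AddCommGroup M] [Module k M]
  [Fintype K] [DecidableEq K] {Msub : K → Submodule k M}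

/-- The linear equivalence between the direct sum and `M` given by an internal decomposition. -/
noncomputable def DirectSum.IsInternal.linearEquiv (h : DirectSum.IsInternal Msub) :
    (⨁ i, Msub i) ≃ₗ[k] M :=
  LinearEquiv.ofBijective (DirectSum.coeLinearMap Msub) h

theorem DirectSum.IsInternal.linearEquiv_apply (h : DirectSum.IsInternal Msub)
    (x : ⨁ i, Msub i) : h.linearEquiv x = ∑ i, (x i : M) := by
  classical
  change DirectSum.coeLinearMap Msub x = _
  rw [DirectSum.coeLinearMap_eq_dfinsuppSum, DFinsupp.sum_eq_sum_fintype _ (fun _ => rfl)]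
  rfl

/-- The projection of `M` onto the `i`-th summand of an internal direct sum decomposition. -/
noncomputable def DirectSum.IsInternal.proj (h : DirectSum.IsInternal Msub) (i : K) :
    M →ₗ[k] Msub i :=
  DirectSum.component k K (fun i => Msub i) i ∘ₗ
    h.linearEquiv.symm.toLinearMap

theorem DirectSum.IsInternal.sum_proj (h : DirectSum.IsInternal Msub) (m : M) :
    ∑ i, (h.proj i m : M) = m := by
  obtain ⟨x, rfl⟩ := h.linearEquiv.surjective m
  simp only [DirectSum.IsInternal.proj, LinearMap.comp_apply, LinearEquiv.coe_coe,
    LinearEquiv.symm_apply_apply]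
  exact (h.linearEquiv_apply x).symm

theorem DirectSum.IsInternal.proj_sum (h : DirectSum.IsInternal Msub)
    (f : ∀ i, Msub i) (j : K) : h.proj j (∑ i, (f i : M)) = f j := by
  have hf : ∑ i, (f i : M) =
      h.linearEquiv ((DirectSum.linearEquivFunOnFintype k K (fun i => Msub i)).symm f) :=
    (h.linearEquiv_apply
      ((DirectSum.linearEquivFunOnFintype k K (fun i => Msub i)).symm f)).symm
  rw [hf, DirectSum.IsInternal.proj, LinearMap.comp_apply, LinearEquiv.coe_coe,
    LinearEquiv.symm_apply_apply]
  rfl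

theorem DirectSum.IsInternal.proj_smul [MulAction G K] (h : DirectSum.IsInternal Msub)
    (ρ : Representation k G M) (hmap : ∀ (g : G) (i : K), (Msub i).map (ρ g) = Msub (g • i))
    (g : G) (i : K) (m : M) : (h.proj (g • i) (ρ g m) : M) = ρ g (h.proj i m) := by
  have hmem (j : K) : ρ g (h.proj (g⁻¹ • j) m) ∈ Msub j := by
    have := Submodule.mem_map_of_mem (f := ρ g) (h.proj (g⁻¹ • j) m).2
    rwa [hmap, smul_inv_smul] at this
  have hsum : ρ g m = ∑ j, ((⟨_, hmem j⟩ : Msub j) : M) := by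
    conv_lhs => rw [← h.sum_proj m, map_sum]
    exact Fintype.sum_equiv (MulAction.toPerm g) _ _ fun j => by
      change _ = ρ g (h.proj (g⁻¹ • g • j) m)
      rw [inv_smul_smul]
  rw [hsum, h.proj_sum]
  change ρ g (h.proj (g⁻¹ • g • i) m) = _
  rw [inv_smul_smul]

/-- The components of an invariant vector are invariant under the stabilizers. -/
theorem DirectSum.IsInternal.proj_mem_fixedSubmodule [MulAction G K]
    (h : DirectSum.IsInternal Msub) (ρ : Representation k G M)
    (hmap : ∀ (g : G) (i : K), (Msub i).map (ρ g) = Msub (g • i))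
    {m : M} (hm : m ∈ fixedSubmodule ρ (Set.univ : Set G)) (i : K) :
    (h.proj i m : M) ∈ Msub i ⊓ fixedSubmodule ρ (MulAction.stabilizer G i) := by
  refine ⟨(h.proj i m).2, fun g hg => ?_⟩
  rw [← h.proj_smul ρ hmap, hm g trivial, MulAction.mem_stabilizer_iff.mp hg]

/-- An invariant vector is sent to its components at the indices in `R`. -/
noncomputable def DirectSum.IsInternal.invariantsProj [MulAction G K]
    (h : DirectSum.IsInternal Msub) (ρ : Representation k G M)
    (hmap : ∀ (g : G) (i : K), (Msub i).map (ρ g) = Msub (g • i)) (R : Finset K) :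
    fixedSubmodule ρ (Set.univ : Set G) →ₗ[k] ∀ i : R,
      (Msub (i : K) ⊓ fixedSubmodule ρ (MulAction.stabilizer G (i : K)) : Submodule k M) :=
  LinearMap.pi fun i => LinearMap.codRestrict _
    ((Msub (i : K)).subtype ∘ₗ h.proj (i : K) ∘ₗ Submodule.subtype _)
    fun m => h.proj_mem_fixedSubmodule ρ hmap m.2 i

theorem DirectSum.IsInternal.invariantsProj_injective [MulAction G K]
    (h : DirectSum.IsInternal Msub) (ρ : Representation k G M)
    (hmap : ∀ (g : G) (i : K), (Msub i).map (ρ g) = Msub (g • i)) (R : Finset K)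
    (hR : ∀ i : K, ∃ r ∈ R, i ∈ MulAction.orbit G r) :
    Function.Injective (h.invariantsProj ρ hmap R) := by
  rw [injective_iff_map_eq_zero]
  rintro ⟨m, hm⟩ h0
  rw [Submodule.mk_eq_zero, ← h.sum_proj m]
  refine Finset.sum_eq_zero fun j _ => ?_
  obtain ⟨r, hr, g, rfl⟩ := hR j
  have hz : (h.proj r m : M) = 0 := congrArg Subtype.val (congrFun h0 ⟨r, hr⟩)
  have := h.proj_smul ρ hmap g r m
  rwa [hm g trivial, hz, map_zero] at this

theorem DirectSum.IsInternal.invariantsProj_surjective [MulAction G K]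
    (h : DirectSum.IsInternal Msub) (ρ : Representation k G M)
    (hmap : ∀ (g : G) (i : K), (Msub i).map (ρ g) = Msub (g • i)) (R : Finset K)
    (hR : ∀ i : K, ∃! r : K, r ∈ R ∧ r ∈ MulAction.orbit G i) :
    Function.Surjective (h.invariantsProj ρ hmap R) := by
  intro x
  have hex (j : K) : ∃ (r : R) (g : G), g • (r : K) = j := by
    obtain ⟨r, ⟨hr, hrj⟩, -⟩ := hR j
    obtain ⟨g, hg⟩ := MulAction.orbit_eq_iff.mpr hrj ▸ MulAction.mem_orbit_self j
    exact ⟨⟨r, hr⟩, g, hg⟩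
  choose r c hc using hex
  have hmem (j : K) : ρ (c j) (x (r j)) ∈ Msub j := by
    have := Submodule.mem_map_of_mem (f := ρ (c j)) (x (r j)).2.1
    rwa [hmap, hc] at this
  have hrep (g : G) (s : R) : ρ g (x s) = ρ (c (g • (s : K))) (x (r (g • (s : K)))) := by
    have hrs : r (g • (s : K)) = s := by
      refine Subtype.ext ((hR (g • (s : K))).unique ⟨(r _).2, ?_⟩ ⟨s.2, ?_⟩)
      · exact ⟨(c (g • (s : K)))⁻¹, inv_smul_eq_iff.mpr (hc _).symm⟩
      · exact ⟨g⁻¹, inv_smul_smul g _⟩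
    have hstab : (c (g • (s : K)))⁻¹ * g ∈ MulAction.stabilizer G (s : K) := by
      have := hc (g • (s : K))
      rw [hrs] at this
      rw [MulAction.mem_stabilizer_iff, mul_smul, inv_smul_eq_iff, this]
    rw [hrs]
    conv_rhs => rw [← (x s).2.2 _ hstab, ← Module.End.mul_apply, ← map_mul, mul_inv_cancel_left]
  refine ⟨⟨∑ j, ((⟨_, hmem j⟩ : Msub j) : M), fun g _ => ?_⟩, ?_⟩
  · rw [map_sum]
    refine Fintype.sum_equiv (MulAction.toPerm g) _ _ fun j => ?_
    have := hrep (g * c j) (r j)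
    rwa [mul_smul, hc, map_mul, Module.End.mul_apply] at this
  · funext s
    refine Subtype.ext ((congrArg Subtype.val (h.proj_sum (fun j => ⟨_, hmem j⟩) s)).trans ?_)
    have := hrep 1 s
    rw [one_smul, map_one, Module.End.one_apply] at this
    exact this.symm

end

/-- Let a finite group `G` act `k`-linearly on `M` via `ρ`, let `K` be a finite
`G`-set, and let `M = ⊕_{i∈K} M_i` be an internal direct sum decomposition with
`ρ(g)(M_i) = M_{g·i}`. If `R ⊆ K` is a set of representatives of the `G`-orbits, then
`M^G ≅ ⊕_{i∈R} M_i^{G_i}` as `k`-vector spaces, `G_i` being the stabilizer of `i`. -/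
theorem invariants_iso_direct_sum_of_orbit_reps
    {k : Type*} [Field k] {G : Type*} [Group G] [Fintype G]
    {M : Type*} [AddCommGroup M] [Module k M]
    (ρ : Representation k G M)
    {K : Type*} [Fintype K] [DecidableEq K] [MulAction G K]
    (Msub : K → Submodule k M)
    (hInternal : DirectSum.IsInternal Msub)
    (hmap : ∀ (g : G) (i : K), (Msub i).map (ρ g) = Msub (g • i))
    (R : Finset K)
    (hR : ∀ i : K, ∃! r : K, r ∈ R ∧ r ∈ MulAction.orbit G i) :
    Nonempty
      ((fixedSubmodule ρ (Set.univ : Set G)) ≃ₗ[k]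
        ⨁ i : R, (Msub (i : K) ⊓ fixedSubmodule ρ (MulAction.stabilizer G (i : K)) :
          Submodule k M)) := by
  have hR' (i : K) : ∃ r ∈ R, i ∈ MulAction.orbit G r := by
    obtain ⟨r, ⟨hr, hri⟩, -⟩ := hR i
    exact ⟨r, hr, MulAction.mem_orbit_symm.mp hri⟩
  exact ⟨(LinearEquiv.ofBijective (hInternal.invariantsProj ρ hmap R)
    ⟨hInternal.invariantsProj_injective ρ hmap R hR',
      hInternal.invariantsProj_surjective ρ hmap R hR⟩).trans
    (DirectSum.linearEquivFunOnFintype k R _).symm⟩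
end

section
/- Let A be a unital associative ℚ-algebra, let I be a totally ordered index set, and let P_i^{(n)}, Q_i^{(n)} ∈ A for i ∈ I and n ≥ 1 be families of elements satisfying, with P_i^{(0)} = Q_i^{(0)} = 1: (i) Q_i^{(m)}·Q_j^{(n)} = Q_j^{(n)}·Q_i^{(m)} and P_i^{(m)}·P_j^{(n)} = P_j^{(n)}·P_i^{(m)} for all i, j ∈ I and m, n ∈ ℕ; and (ii) Q_i^{(m)}·P_j^{(n)} = Σ_{k=0}^{min{m,n}} c_{ij}^{(k)} · P_j^{(n−k)}·Q_i^{(m−k)} for some scalars c_{ij}^{(k)} ∈ ℚ with c_{ij}^{(0)} = 1. Then every element of the subalgebra of A generated by all the P_i^{(n)} and Q_i^{(n)} is a ℚ-linear combination of the normally ordered monomials p(ν)q(μ) := ∏_{i∈I} ∏_{k≥1} (P_i^{(k)})^{ν(i)_k} · ∏_{i∈I} ∏_{k≥1} (Q_i^{(k)})^{μ(i)_k}, where ν, μ range over finitely supported functions assigning to each i ∈ I a partition (written ν(i) = 1^{ν(i)_1} 2^{ν(i)_2} ⋯), the inner products taken in increasing order of k and the outer products in the fixed order of I. -/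
/-- The normally ordered monomial `∏_{i∈I} ∏_{k≥1} (f i k)^{ν(i)_k}` attached to a finitely
supported function `ν` from a totally ordered index set `I` to partitions (a partition being
recorded by its multiplicities `ν(i)_k`, the number of parts equal to `k`); the inner product
is taken in increasing order of `k` and the outer product in increasing order of `I`. -/
def orderedMonomial {I : Type*} [LinearOrder I] {A : Type*} [Monoid A]
    (f : I → ℕ → A) (ν : I →₀ (ℕ →₀ ℕ)) : A :=
  ((ν.support.sort (· ≤ ·)).map fun i =>
    ((((ν i).support.filter fun k => k ≠ 0).sort (· ≤ ·)).map fun k =>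
      f i k ^ ν i k).prod).prod

/-- Monoid homomorphisms commute with ordered monomials. -/
theorem map_orderedMonomial {I : Type*} [LinearOrder I] {M A : Type*} [Monoid M] [Monoid A]
    (φ : M →* A) (f : I → ℕ → M) (ν : I →₀ (ℕ →₀ ℕ)) :
    φ (orderedMonomial f ν) = orderedMonomial (fun i k => φ (f i k)) ν := by
  simp [orderedMonomial, map_list_prod, Function.comp_def]

theorem Finset.prod_map_sort {ι M : Type*} [LinearOrder ι] [CommMonoid M] (s : Finset ι)
    (g : ι → M) : ((s.sort (· ≤ ·)).map g).prod = ∏ i ∈ s, g i := by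
  rw [← List.prod_toFinset g (s.sort_nodup _), Finset.sort_toFinset]

/-- In a commutative monoid the order of the factors is irrelevant. -/
theorem orderedMonomial_eq_prod {I : Type*} [LinearOrder I] {M : Type*} [CommMonoid M]
    (f : I → ℕ → M) (ν : I →₀ (ℕ →₀ ℕ)) :
    orderedMonomial f ν = ν.prod fun i a => a.prod fun k e => if k ≠ 0 then f i k ^ e else 1 := by
  simp only [orderedMonomial, Finset.prod_map_sort, Finsupp.prod, Finset.prod_filter]

theorem orderedMonomial_zero {I : Type*} [LinearOrder I] {M : Type*} [Monoid M]
    (f : I → ℕ → M) : orderedMonomial f 0 = 1 := by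
  simp [orderedMonomial]

theorem orderedMonomial_add {I : Type*} [LinearOrder I] {M : Type*} [CommMonoid M]
    (f : I → ℕ → M) (ν μ : I →₀ (ℕ →₀ ℕ)) :
    orderedMonomial f (ν + μ) = orderedMonomial f ν * orderedMonomial f μ := by
  simp only [orderedMonomial_eq_prod]
  refine Finsupp.prod_add_index' (fun i => Finsupp.prod_zero_index) fun i a b => ?_
  refine Finsupp.prod_add_index' (fun k => by simp) fun k d e => ?_
  split_ifs <;> simp [pow_add]

theorem orderedMonomial_single {I : Type*} [LinearOrder I] {M : Type*} [CommMonoid M]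
    (f : I → ℕ → M) (i : I) {n : ℕ} (hn : n ≠ 0) :
    orderedMonomial f (Finsupp.single i (Finsupp.single n 1)) = f i n := by
  rw [orderedMonomial_eq_prod, Finsupp.prod_single_index (by simp),
    Finsupp.prod_single_index (by simp)]
  simp [hn]

open scoped IsMulCommutative in
/-- The multiplicative closure of a commuting family consists of ordered monomials. -/
theorem exists_orderedMonomial_of_mem_closure {I : Type*} [LinearOrder I] {A : Type*} [Monoid A]
    (f : I → ℕ → A) (hf : ∀ (i j : I) (m n : ℕ), f i m * f j n = f j n * f i m)
    {x : A} (hx : x ∈ Submonoid.closure {y | ∃ (i : I) (n : ℕ), 1 ≤ n ∧ y = f i n}) :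
    ∃ ν : I →₀ (ℕ →₀ ℕ), x = orderedMonomial f ν := by
  let S : Set A := {y | ∃ (i : I) (n : ℕ), y = f i n}
  have : IsMulCommutative (Submonoid.closure S) := Submonoid.isMulCommutative_closure A (by
    rintro _ ⟨i, m, rfl⟩ _ ⟨j, n, rfl⟩
    exact hf i j m n)
  let g : I → ℕ → Submonoid.closure S :=
    fun i n => ⟨f i n, Submonoid.subset_closure ⟨i, n, rfl⟩⟩
  have hg : ∀ ν, orderedMonomial f ν = (orderedMonomial g ν : Submonoid.closure S) :=
    fun ν => (map_orderedMonomial (Submonoid.closure S).subtype g ν).symm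
  induction hx using Submonoid.closure_induction with
  | mem x h =>
    obtain ⟨i, n, hn, rfl⟩ := h
    exact ⟨Finsupp.single i (Finsupp.single n 1), by
      rw [hg, orderedMonomial_single g i (by omega)]⟩
  | one => exact ⟨0, (orderedMonomial_zero f).symm⟩
  | mul x y _ _ hx hy =>
    obtain ⟨ν, rfl⟩ := hx
    obtain ⟨μ, rfl⟩ := hy
    exact ⟨ν + μ, by simp only [hg, orderedMonomial_add]; rfl⟩

/-- The subalgebra generated by a commuting family is spanned by ordered monomials. -/
theorem adjoin_le_span_orderedMonomial {R : Type*} [CommSemiring R] {I : Type*} [LinearOrder I]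
    {A : Type*} [Semiring A] [Algebra R A]
    (f : I → ℕ → A) (hf : ∀ (i j : I) (m n : ℕ), f i m * f j n = f j n * f i m) :
    Subalgebra.toSubmodule (Algebra.adjoin R {y | ∃ (i : I) (n : ℕ), 1 ≤ n ∧ y = f i n}) ≤
      Submodule.span R {y | ∃ ν : I →₀ (ℕ →₀ ℕ), y = orderedMonomial f ν} := by
  rw [Algebra.adjoin_eq_span]
  exact Submodule.span_mono fun x hx => exists_orderedMonomial_of_mem_closure f hf hx

/-- If every product `t * s` with `t ∈ T` and `s ∈ S` can be straightened into
`adjoin S * span (T ∪ {1})`, then the algebra generated by `S ∪ T` is contained in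
`adjoin S * adjoin T`. -/
theorem adjoin_union_le_mul_of_straightening {R : Type*} [CommSemiring R] {A : Type*} [Semiring A]
    [Algebra R A] (S T : Set A)
    (h : ∀ t ∈ T, ∀ s ∈ S, t * s ∈
      Subalgebra.toSubmodule (Algebra.adjoin R S) * Submodule.span R (insert 1 T)) :
    Subalgebra.toSubmodule (Algebra.adjoin R (S ∪ T)) ≤
      Subalgebra.toSubmodule (Algebra.adjoin R S) *
        Subalgebra.toSubmodule (Algebra.adjoin R T) := by
  set U := Subalgebra.toSubmodule (Algebra.adjoin R S) with hU
  set V := Subalgebra.toSubmodule (Algebra.adjoin R T) with hV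
  have hUU : U * U = U := Subalgebra.isIdempotentElem_toSubmodule _
  have hVV : V * V = V := Subalgebra.isIdempotentElem_toSubmodule _
  have h1U : (1 : A) ∈ U := one_mem (Algebra.adjoin R S)
  have h1V : (1 : A) ∈ V := one_mem (Algebra.adjoin R T)
  have hUN : U * (U * V) = U * V := by rw [← mul_assoc, hUU]
  have hNV : U * V * V = U * V := by rw [mul_assoc, hVV]
  have hswap : ∀ x ∈ U, ∀ t ∈ Submodule.span R (insert 1 T), t * x ∈ U * V := by
    intro x hx
    rw [hU, Algebra.adjoin_eq_span] at hx
    induction hx using Submodule.span_induction with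
    | zero => intro t _; simp
    | add x y _ _ hx hy => intro t ht; rw [mul_add]; exact add_mem (hx t ht) (hy t ht)
    | smul r x _ hx => intro t ht; rw [mul_smul_comm]; exact Submodule.smul_mem _ _ (hx t ht)
    | mem x hx =>
      induction hx using Submonoid.closure_induction_left with
      | one =>
        intro t ht
        rw [mul_one, ← one_mul t]
        refine Submodule.mul_mem_mul h1U (Submodule.span_le.2 ?_ ht)
        exact Set.insert_subset h1V Algebra.subset_adjoin
      | mul_left s hs y hy ih =>
        have hyU : y ∈ U := by
          rw [hU, Algebra.adjoin_eq_span]; exact Submodule.subset_span hy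
        have hsU : s ∈ U := Algebra.subset_adjoin hs
        intro t ht
        induction ht using Submodule.span_induction with
        | zero => simp
        | add a b _ _ ha hb => rw [add_mul]; exact add_mem ha hb
        | smul r a _ ha => rw [smul_mul_assoc]; exact Submodule.smul_mem _ _ ha
        | mem t ht =>
          rcases ht with rfl | ht
          · rw [one_mul, ← mul_one (s * y)]
            exact Submodule.mul_mem_mul (hUU ▸ Submodule.mul_mem_mul hsU hyU) h1V
          · rw [← mul_assoc]
            refine Submodule.mul_induction_on (h t ht s hs) (fun u hu v hv => ?_)
              fun a b ha hb => ?_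
            · rw [mul_assoc, ← hUN]
              exact Submodule.mul_mem_mul hu (ih v hv)
            · rw [add_mul]; exact add_mem ha hb
  have hstable : ∀ x ∈ Algebra.adjoin R (S ∪ T), ∀ y ∈ U * V, x * y ∈ U * V := by
    intro x hx
    induction hx using Algebra.adjoin_induction with
    | mem x hx =>
      intro y hy
      rcases hx with hx | hx
      · rw [← hUN]
        exact Submodule.mul_mem_mul (Algebra.subset_adjoin hx) hy
      · refine Submodule.mul_induction_on hy (fun u hu v hv => ?_) fun a b ha hb => ?_
        · rw [← mul_assoc, ← hNV]
          exact Submodule.mul_mem_mul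
            (hswap u hu x (Submodule.subset_span (Set.mem_insert_of_mem _ hx))) hv
        · rw [mul_add]; exact add_mem ha hb
    | algebraMap r =>
      intro y hy
      rw [← Algebra.smul_def]
      exact Submodule.smul_mem _ _ hy
    | add a b _ _ ha hb => intro y hy; rw [add_mul]; exact add_mem (ha y hy) (hb y hy)
    | mul a b _ _ ha hb => intro y hy; rw [mul_assoc]; exact ha _ (hb y hy)
  intro x hx
  have := hstable x hx (1 * 1) (Submodule.mul_mem_mul h1U h1V)
  simpa using this

/-- If families `P i n`, `Q i n` (with `P i 0 = Q i 0 = 1`) in a unital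
associative ℚ-algebra satisfy the commutation relations (i) and the straightening relation
(ii) with scalars `c i j k ∈ ℚ`, `c i j 0 = 1`, then every element of the subalgebra they
generate is a ℚ-linear combination of the normally ordered monomials `p(ν)·q(μ)`. -/
theorem span_of_normally_ordered_monomials
    {A : Type*} [Ring A] [Algebra ℚ A] {I : Type*} [LinearOrder I]
    (P Q : I → ℕ → A) (c : I → I → ℕ → ℚ)
    (hP0 : ∀ i, P i 0 = 1) (hQ0 : ∀ i, Q i 0 = 1) (hc0 : ∀ i j, c i j 0 = 1)
    (hQQ : ∀ (i j : I) (m n : ℕ), Q i m * Q j n = Q j n * Q i m)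
    (hPP : ∀ (i j : I) (m n : ℕ), P i m * P j n = P j n * P i m)
    (hQP : ∀ (i j : I) (m n : ℕ), Q i m * P j n =
      ∑ k ∈ Finset.range (min m n + 1), c i j k • (P j (n - k) * Q i (m - k)))
    (x : A)
    (hx : x ∈ Algebra.adjoin ℚ
      ({y | ∃ (i : I) (n : ℕ), 1 ≤ n ∧ y = P i n} ∪
       {y | ∃ (i : I) (n : ℕ), 1 ≤ n ∧ y = Q i n})) :
    x ∈ Submodule.span ℚ
      {y | ∃ ν μ : I →₀ (ℕ →₀ ℕ), y = orderedMonomial P ν * orderedMonomial Q μ} := by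
  have hsub := adjoin_union_le_mul_of_straightening (R := ℚ)
    {y | ∃ (i : I) (n : ℕ), 1 ≤ n ∧ y = P i n} {y | ∃ (i : I) (n : ℕ), 1 ≤ n ∧ y = Q i n} (by
      rintro _ ⟨i, m, -, rfl⟩ _ ⟨j, n, -, rfl⟩
      rw [hQP]
      refine sum_mem fun k _ => Submodule.smul_mem _ _ (Submodule.mul_mem_mul ?_ ?_)
      · rcases Nat.eq_zero_or_pos (n - k) with h | h
        · rw [h, hP0]
          exact one_mem (Algebra.adjoin ℚ _)
        · exact Algebra.subset_adjoin ⟨j, _, h, rfl⟩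
      · refine Submodule.subset_span ?_
        rcases Nat.eq_zero_or_pos (m - k) with h | h
        · exact Or.inl (by rw [h, hQ0])
        · exact Or.inr ⟨i, _, h, rfl⟩)
  have hmem := mul_le_mul' (adjoin_le_span_orderedMonomial (R := ℚ) P hPP)
    (adjoin_le_span_orderedMonomial (R := ℚ) Q hQQ) (hsub hx)
  rw [Submodule.span_mul_span] at hmem
  refine Submodule.span_mono ?_ hmem
  rintro _ ⟨_, ⟨ν, rfl⟩, _, ⟨μ, rfl⟩, rfl⟩
  exact ⟨ν, μ, rfl⟩
end

section
/- Let A be a unital associative ℚ-algebra and let x_1, x_2, x_3, … ∈ A be pairwise commuting elements. Define p^{(0)} = 1 and n·p^{(n)} = Σ_{ℓ=1}^{n} x_ℓ·p^{(n−ℓ)} for n ≥ 1. Then for every n ≥ 0, p^{(n)} = Σ_{ν ⊢ n} ∏_{ℓ≥1} x_ℓ^{m_ℓ(ν)} / (ℓ^{m_ℓ(ν)}·m_ℓ(ν)!), the sum being over all partitions ν of n, where m_ℓ(ν) is the number of parts of ν equal to ℓ. (This expresses the equivalence of the recursive definition of p^{(n)} with the generating-function definition Σ_{n≥0} p^{(n)}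 z^n = exp(Σ_{ℓ≥1} x_ℓ z^ℓ/ℓ).) -/
/-- The contribution of parts of size `l`, used `k` times, to the weight of a partition. -/
noncomputable def partWeight {A : Type*} [Ring A] [Algebra ℚ A] (x : ℕ → A) (l k : ℕ) : A :=
  (((l : ℚ) ^ k * (k.factorial : ℚ))⁻¹) • x l ^ k

@[simp] lemma partWeight_zero {A : Type*} [Ring A] [Algebra ℚ A] (x : ℕ → A) (l : ℕ) :
    partWeight x l 0 = 1 := by
  simp [partWeight]

lemma smul_partWeight_succ {A : Type*} [Ring A] [Algebra ℚ A] (x : ℕ → A) {l : ℕ} (hl : l ≠ 0)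
    (k : ℕ) :
    ((l : ℚ) * (k + 1 : ℕ)) • partWeight x l (k + 1) = x l * partWeight x l k := by
  rw [partWeight, partWeight, smul_smul, mul_smul_comm, ← pow_succ']
  congr 1
  have hl' : (l : ℚ) ≠ 0 := by exact_mod_cast hl
  have hk : (k.factorial : ℚ) ≠ 0 := by exact_mod_cast k.factorial_ne_zero
  have hk' : (k : ℚ) + 1 ≠ 0 := by positivity
  rw [Nat.factorial_succ]
  push_cast
  field_simp
  ring

/-- The weight of a multiset of parts taken from `N`. -/
noncomputable def partsWeight {B : Type*} [CommRing B] [Algebra ℚ B] (y : ℕ → B) (N : Finset ℕ)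
    (s : Multiset ℕ) : B :=
  ∏ l ∈ N, partWeight y l (s.count l)

section CommRing

variable {B : Type*} [CommRing B] [Algebra ℚ B] (y : ℕ → B)

lemma smul_partsWeight_cons {N : Finset ℕ} {a : ℕ} (ha : a ∈ N) (ha0 : a ≠ 0) (s : Multiset ℕ) :
    ((a : ℚ) * ((a ::ₘ s).count a : ℕ)) • partsWeight y N (a ::ₘ s) = y a * partsWeight y N s := by
  rw [partsWeight, partsWeight, ← Finset.mul_prod_erase N _ ha, ← Finset.mul_prod_erase N _ ha,
    Multiset.count_cons_self, ← smul_mul_assoc, smul_partWeight_succ y ha0, mul_assoc]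
  congr 2
  refine Finset.prod_congr rfl fun l hl => ?_
  rw [Multiset.count_cons_of_ne (Finset.ne_of_mem_erase hl)]

lemma partsWeight_eq_of_subset {M N : Finset ℕ} (h : M ⊆ N) {s : Multiset ℕ}
    (hs : ∀ l ∈ s, l ∈ M) : partsWeight y M s = partsWeight y N s :=
  Finset.prod_subset h fun l _ hl => by
    rw [Multiset.count_eq_zero_of_notMem fun hl' => hl (hs l hl'), partWeight_zero]

/-- The sum of the weights of all partitions of `n`. -/
noncomputable def partitionSum (n : ℕ) : B :=
  ∑ ν : n.Partition, partsWeight y (Finset.Icc 1 n) ν.parts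

lemma sum_mul_count_partition {n : ℕ} (ν : n.Partition) :
    ∑ l ∈ Finset.Icc 1 n, l * ν.parts.count l = n := by
  conv_rhs => rw [← ν.parts_sum, Finset.sum_multiset_count]
  simp only [smul_eq_mul, mul_comm]
  refine (Finset.sum_subset (fun l hl => ?_) fun l _ hl => ?_).symm
  · rw [Multiset.mem_toFinset] at hl
    exact Finset.mem_Icc.2 ⟨ν.parts_pos hl, Nat.Partition.le_of_mem_parts hl⟩
  · rw [Multiset.count_eq_zero_of_notMem (by simpa using hl), mul_zero]

lemma sum_smul_count_partsWeight {n l : ℕ} (hl : 1 ≤ l) (hln : l ≤ n) :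
    ∑ ν : n.Partition, ((l : ℚ) * (ν.parts.count l : ℕ)) • partsWeight y (Finset.Icc 1 n) ν.parts
      = y l * partitionSum y (n - l) := by
  classical
  have hsub : Finset.Icc 1 (n - l) ⊆ Finset.Icc 1 n := Finset.Icc_subset_Icc_right (n.sub_le l)
  rw [← Finset.sum_filter_add_sum_filter_not Finset.univ fun ν : n.Partition => l ∈ ν.parts,
    Finset.sum_eq_zero (s := Finset.univ.filter fun ν : n.Partition => ¬ l ∈ ν.parts), add_zero,
    Finset.sum_subtype (p := fun ν : n.Partition => l ∈ ν.parts) _ (by simp),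
    ← (Nat.Partition.partitionWithPartEquiv hl hln).symm.sum_comp, partitionSum, Finset.mul_sum]
  · refine Finset.sum_congr rfl fun μ _ => ?_
    rw [Nat.Partition.partitionWithPartEquiv_symm_apply_parts,
      smul_partsWeight_cons y (Finset.mem_Icc.2 ⟨hl, hln⟩) (by lia),
      partsWeight_eq_of_subset y hsub fun k hk =>
        Finset.mem_Icc.2 ⟨μ.parts_pos hk, Nat.Partition.le_of_mem_parts hk⟩]
  · intro ν hν
    rw [Multiset.count_eq_zero_of_notMem (Finset.mem_filter.1 hν).2]
    simp

lemma partitionSum_zero : partitionSum y 0 = 1 := by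
  simp [partitionSum, partsWeight]

/-- Newton's recursion for the sum of the weights of all partitions. -/
lemma smul_partitionSum (n : ℕ) :
    (n : ℚ) • partitionSum y n = ∑ l ∈ Finset.Icc 1 n, y l * partitionSum y (n - l) := by
  rw [← Finset.sum_congr rfl fun l hl => sum_smul_count_partsWeight y (Finset.mem_Icc.1 hl).1
    (Finset.mem_Icc.1 hl).2, Finset.sum_comm, partitionSum, Finset.smul_sum]
  refine Finset.sum_congr rfl fun ν _ => ?_
  rw [← Finset.sum_smul]
  congr 1
  exact_mod_cast (sum_mul_count_partition ν).symm

end CommRing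

/-- A sequence is determined by its initial value and Newton's recursion. -/
lemma eq_of_newton_recursion {A : Type*} [Ring A] [Algebra ℚ A] {x p q : ℕ → A} (h0 : p 0 = q 0)
    (hp : ∀ n : ℕ, 1 ≤ n → (n : ℚ) • p n = ∑ l ∈ Finset.Icc 1 n, x l * p (n - l))
    (hq : ∀ n : ℕ, 1 ≤ n → (n : ℚ) • q n = ∑ l ∈ Finset.Icc 1 n, x l * q (n - l)) (n : ℕ) :
    p n = q n := by
  induction n using Nat.strong_induction_on with
  | _ n ih =>
    obtain rfl | hn := Nat.eq_zero_or_pos n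
    · exact h0
    · have hn' : (n : ℚ) ≠ 0 := by exact_mod_cast hn.ne'
      apply smul_right_injective A hn'
      change (n : ℚ) • p n = (n : ℚ) • q n
      rw [hp n hn, hq n hn]
      refine Finset.sum_congr rfl fun l hl => ?_
      rw [Finset.mem_Icc] at hl
      rw [ih (n - l) (by lia)]

/-- Let `x 1, x 2, …` be pairwise commuting elements of a unital associative
ℚ-algebra `A` and define `p 0 = 1`, `n·p n = Σ_{ℓ=1}^{n} x ℓ · p (n−ℓ)` for `n ≥ 1`. Then
`p n = Σ_{ν ⊢ n} ∏_{ℓ≥1} x_ℓ^{m_ℓ(ν)} / (ℓ^{m_ℓ(ν)}·m_ℓ(ν)!)`, the sum running over all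
partitions `ν` of `n`, where `m_ℓ(ν)` is the number of parts of `ν` equal to `ℓ` (the product
over `ℓ` is taken in increasing order, which is immaterial since the `x ℓ` commute). -/
theorem newton_exp_formula
    {A : Type*} [Ring A] [Algebra ℚ A]
    (x : ℕ → A) (hcomm : ∀ i j : ℕ, Commute (x i) (x j))
    (p : ℕ → A) (hp0 : p 0 = 1)
    (hrec : ∀ n : ℕ, 1 ≤ n →
      (n : ℚ) • p n = ∑ ℓ ∈ Finset.Icc 1 n, x ℓ * p (n - ℓ)) :
    ∀ n : ℕ, p n =
      ∑ ν : n.Partition,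
        (((Finset.Icc 1 n).sort (· ≤ ·)).map fun (ℓ : ℕ) =>
          (((ℓ : ℚ) ^ (Multiset.count ℓ ν.parts) *
              ((Multiset.count ℓ ν.parts).factorial : ℚ))⁻¹) •
            x ℓ ^ (Multiset.count ℓ ν.parts)).prod := by
  intro n
  let S : Subalgebra ℚ A := Algebra.adjoin ℚ (Set.range x)
  have : IsMulCommutative S := Algebra.isMulCommutative_adjoin ℚ <| by
    rintro _ ⟨i, rfl⟩ _ ⟨j, rfl⟩
    exact hcomm i j
  let _ : CommRing S := { mul_comm := mul_comm' }
  let y : ℕ → S := fun i => ⟨x i, Algebra.subset_adjoin ⟨i, rfl⟩⟩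
  have hy : ∀ i, S.val (y i) = x i := fun _ => rfl
  rw [eq_of_newton_recursion (q := fun n => S.val (partitionSum y n))
    (by rw [hp0, partitionSum_zero]; exact (map_one S.val).symm) hrec]
  · simp only [partitionSum, map_sum]
    refine Finset.sum_congr rfl fun ν _ => ?_
    rw [partsWeight, Finset.prod_eq_multiset_prod, ← Finset.sort_eq (Finset.Icc 1 n) (· ≤ ·),
      Multiset.map_coe, Multiset.prod_coe, map_list_prod, List.map_map]
    congr 1
  · intro m _
    rw [← map_smul, smul_partitionSum, map_sum]
    simp only [map_mul, hy]
end
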